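/- The function B_β = k cos φ − p_φ² cos φ/(m r sin⁴φ) − p_r p_φ/(m sin φ) is a first integral of the Kepler Hamiltonian in conformable polar coordinates: at every point (r, φ, p_r, p_φ) with r > 0 and sin φ ≠ 0, {K, B_β} = 0. -/

import Mathlib

noncomputable section

/-- Partial derivative with respect to the first coordinate `r`. -/
def pdR (f : ℝ → ℝ → ℝ → ℝ → ℝ) (r φ pr pφ : ℝ) : ℝ :=
  deriv (fun x => f x φ pr pφ) r

/-- Partial derivative with respect to the second coordinate `φ`. -/
def pdPhi (f : ℝ → ℝ → ℝ → ℝ → ℝ) (r φ pr pφ : ℝ) : ℝ :=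
  deriv (fun x => f r x pr pφ) φ

/-- Partial derivative with respect to the third coordinate `p_r`. -/
def pdPr (f : ℝ → ℝ → ℝ → ℝ → ℝ) (r φ pr pφ : ℝ) : ℝ :=
  deriv (fun x => f r φ x pφ) pr

/-- Partial derivative with respect to the fourth coordinate `p_φ`. -/
def pdPphi (f : ℝ → ℝ → ℝ → ℝ → ℝ) (r φ pr pφ : ℝ) : ℝ :=
  deriv (fun x => f r φ pr x) pφ

/-- The Poisson bracket in conformable polar coordinates:
`{f,g} = (∂f/∂p_r ∂g/∂r - ∂f/∂r ∂g/∂p_r) + sin²φ (∂f/∂p_φ ∂g/∂φ - ∂f/∂φ ∂g/∂p_φ)`. -/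
def polarPB (f g : ℝ → ℝ → ℝ → ℝ → ℝ) (r φ pr pφ : ℝ) : ℝ :=
  (pdPr f r φ pr pφ * pdR g r φ pr pφ - pdR f r φ pr pφ * pdPr g r φ pr pφ) +
  Real.sin φ ^ 2 *
    (pdPphi f r φ pr pφ * pdPhi g r φ pr pφ - pdPhi f r φ pr pφ * pdPphi g r φ pr pφ)

/-- The Kepler Hamiltonian in conformable polar coordinates:
`K = p_r²/(2m) + p_φ²/(2m r² sin⁴φ) - k/r`. -/
def polarK (m k : ℝ) (r φ pr pφ : ℝ) : ℝ :=
  pr ^ 2 / (2 * m) + pφ ^ 2 / (2 * m * r ^ 2 * Real.sin φ ^ 4) - k / r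

section PartialDerivatives

variable {m k r φ pr pφ : ℝ}

/-- The function `B_β`, as a function of the four coordinates. -/
def polarBbeta (m k : ℝ) (r φ pr pφ : ℝ) : ℝ :=
  k * Real.cos φ - pφ ^ 2 * Real.cos φ / (m * r * Real.sin φ ^ 4) - pr * pφ / (m * Real.sin φ)

theorem pdPr_polarK : pdPr (polarK m k) r φ pr pφ = pr / m := by
  refine HasDerivAt.deriv (((((hasDerivAt_id' pr).fun_pow 2).div_const (2 * m)).add_const
    (pφ ^ 2 / (2 * m * r ^ 2 * Real.sin φ ^ 4))).sub_const (k / r) |>.congr_deriv ?_)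
  field_simp
  norm_num

theorem pdPphi_polarK :
    pdPphi (polarK m k) r φ pr pφ = pφ / (m * r ^ 2 * Real.sin φ ^ 4) := by
  refine HasDerivAt.deriv (((((hasDerivAt_id' pφ).fun_pow 2).div_const
    (2 * m * r ^ 2 * Real.sin φ ^ 4)).const_add (pr ^ 2 / (2 * m))).sub_const (k / r)
    |>.congr_deriv ?_)
  field_simp
  norm_num

theorem pdR_polarK (hm : m ≠ 0) (hr : r ≠ 0) (hs : Real.sin φ ≠ 0) :
    pdR (polarK m k) r φ pr pφ = k / r ^ 2 - pφ ^ 2 / (m * r ^ 3 * Real.sin φ ^ 4) := by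
  have hden : HasDerivAt (fun x => 2 * m * x ^ 2 * Real.sin φ ^ 4) _ r :=
    (((hasDerivAt_id' r).fun_pow 2).const_mul (2 * m)).mul_const (Real.sin φ ^ 4)
  refine HasDerivAt.deriv ((((hasDerivAt_const r (pφ ^ 2)).fun_div hden (by positivity)).const_add
    (pr ^ 2 / (2 * m))).fun_sub ((hasDerivAt_const r k).fun_div (hasDerivAt_id' r) hr)
    |>.congr_deriv ?_)
  field_simp
  ring

theorem pdPhi_polarK (hm : m ≠ 0) (hr : r ≠ 0) (hs : Real.sin φ ≠ 0) :
    pdPhi (polarK m k) r φ pr pφ =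
      -(2 * pφ ^ 2 * Real.cos φ) / (m * r ^ 2 * Real.sin φ ^ 5) := by
  have hden : HasDerivAt (fun x => 2 * m * r ^ 2 * Real.sin x ^ 4) _ φ :=
    ((Real.hasDerivAt_sin φ).fun_pow 4).const_mul (2 * m * r ^ 2)
  refine HasDerivAt.deriv ((((hasDerivAt_const φ (pφ ^ 2)).fun_div hden (by positivity)).const_add
    (pr ^ 2 / (2 * m))).sub_const (k / r) |>.congr_deriv ?_)
  field_simp
  ring

theorem pdPr_polarBbeta :
    pdPr (polarBbeta m k) r φ pr pφ = -pφ / (m * Real.sin φ) := by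
  refine HasDerivAt.deriv ((((hasDerivAt_id' pr).mul_const pφ).div_const
    (m * Real.sin φ)).const_sub
    (k * Real.cos φ - pφ ^ 2 * Real.cos φ / (m * r * Real.sin φ ^ 4)) |>.congr_deriv ?_)
  ring

theorem pdPphi_polarBbeta :
    pdPphi (polarBbeta m k) r φ pr pφ =
      -(2 * pφ * Real.cos φ) / (m * r * Real.sin φ ^ 4) - pr / (m * Real.sin φ) := by
  refine HasDerivAt.deriv ((((((hasDerivAt_id' pφ).fun_pow 2).mul_const (Real.cos φ)).div_const
    (m * r * Real.sin φ ^ 4)).const_sub (k * Real.cos φ)).fun_sub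
    (((hasDerivAt_id' pφ).const_mul pr).div_const (m * Real.sin φ)) |>.congr_deriv ?_)
  norm_num
  ring

theorem pdR_polarBbeta (hm : m ≠ 0) (hr : r ≠ 0) (hs : Real.sin φ ≠ 0) :
    pdR (polarBbeta m k) r φ pr pφ =
      pφ ^ 2 * Real.cos φ / (m * r ^ 2 * Real.sin φ ^ 4) := by
  have hden : HasDerivAt (fun x => m * x * Real.sin φ ^ 4) _ r :=
    ((hasDerivAt_id' r).const_mul m).mul_const (Real.sin φ ^ 4)
  refine HasDerivAt.deriv ((((hasDerivAt_const r (pφ ^ 2 * Real.cos φ)).fun_div hden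
    (by positivity)).const_sub (k * Real.cos φ)).sub_const (pr * pφ / (m * Real.sin φ))
    |>.congr_deriv ?_)
  field_simp
  ring

theorem pdPhi_polarBbeta (hm : m ≠ 0) (hr : r ≠ 0) (hs : Real.sin φ ≠ 0) :
    pdPhi (polarBbeta m k) r φ pr pφ =
      -(k * Real.sin φ) + pφ ^ 2 / (m * r * Real.sin φ ^ 3)
        + 4 * pφ ^ 2 * Real.cos φ ^ 2 / (m * r * Real.sin φ ^ 5)
        + pr * pφ * Real.cos φ / (m * Real.sin φ ^ 2) := by
  have hden : HasDerivAt (fun x => m * r * Real.sin x ^ 4) _ φ :=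
    ((Real.hasDerivAt_sin φ).fun_pow 4).const_mul (m * r)
  refine HasDerivAt.deriv ((((Real.hasDerivAt_cos φ).const_mul k).fun_sub
    (((Real.hasDerivAt_cos φ).const_mul (pφ ^ 2)).fun_div hden (by positivity))).fun_sub
    ((hasDerivAt_const φ (pr * pφ)).fun_div ((Real.hasDerivAt_sin φ).const_mul m)
      (by positivity)) |>.congr_deriv ?_)
  field_simp
  ring

end PartialDerivatives

/-- `B_β = k cos φ - p_φ² cos φ/(m r sin⁴φ) - p_r p_φ/(m sin φ)`
is a first integral of the Kepler Hamiltonian in conformable polar coordinates. -/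
theorem polarPB_K_Bbeta_eq_zero
    (m k : ℝ) (hm : 0 < m) (r φ pr pφ : ℝ) (hr : 0 < r) (hs : Real.sin φ ≠ 0) :
    polarPB (polarK m k)
      (fun r φ pr pφ => k * Real.cos φ - pφ ^ 2 * Real.cos φ / (m * r * Real.sin φ ^ 4)
        - pr * pφ / (m * Real.sin φ)) r φ pr pφ = 0 := by
  have hm' := hm.ne'
  have hr' := hr.ne'
  change polarPB (polarK m k) (polarBbeta m k) r φ pr pφ = 0
  rw [polarPB, pdPr_polarK, pdPphi_polarK, pdR_polarK hm' hr' hs, pdPhi_polarK hm' hr' hs,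
    pdPr_polarBbeta, pdPphi_polarBbeta, pdR_polarBbeta hm' hr' hs, pdPhi_polarBbeta hm' hr' hs]
  field_simp
  ring
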